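/- Let V be a bounded 𝕂̄-fold algebra satisfying skew-symmetry for a translation generator 𝐓 (an even commuting pair for which every Ya is translation covariant). Then homogeneous elements a,b∈V are local in the direct channel (i.e. the distributions Ya, Yb are local) if and only if a,b are dual in the direct channel. -/

import Mathlib

open scoped BigOperators Classical

noncomputable section

namespace OPEA

variable (K : Type*) [Field K] [CharZero K]

/-- index pairs 𝐧 = (n, n̄) ∈ K² -/
abbrev Idx := K × K

def IsInt (x : K) : Prop := ∃ k : ℤ, (k : K) = x

def IsNegInt (x : K) : Prop := ∃ k : ℤ, k < 0 ∧ (k : K) = x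

/-- 𝕂̄ = {𝐧 ∈ K² | n − n̄ ∈ ℤ} -/
def Kbar (n : Idx K) : Prop := IsInt K (n.1 - n.2)

def IsIntPair (n : Idx K) : Prop := IsInt K n.1 ∧ IsInt K n.2

/-- generalized binomial coefficient C(x,k) -/
def gchoose (x : K) (k : ℕ) : K :=
  (∏ i ∈ Finset.range k, (x - (i : K))) / (k.factorial : K)

/-- (−1)^x for x an integer image in K (and 1 otherwise) -/
def negOnePow (x : K) : K :=
  if h : ∃ k : ℤ, (k : K) = x then (-1 : K) ^ h.choose else 1

variable (M : Type*) [AddCommGroup M] [Module K M]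

/-- M-valued distribution in one variable pair -/
abbrev Dist1 := Idx K → M

/-- M-valued distribution in two variable pairs -/
abbrev Dist2 := Idx K → Idx K → M

/-- M-valued distribution in r variable pairs -/
abbrev DistN (r : ℕ) := (Fin r → Idx K) → M

/-- membership in M[[𝐳]] -/
def IsPow1 (a : Dist1 K M) : Prop := ∀ n, a n ≠ 0 → IsNegInt K n.1 ∧ IsNegInt K n.2

/-- membership in M⌊𝐳⌋ -/
def InLat1 (a : Dist1 K M) : Prop :=
  ∃ S : Finset (Idx K), ∀ n, a n ≠ 0 →
    ∃ m ∈ S, IsNegInt K (n.1 - m.1) ∧ IsNegInt K (n.2 - m.2)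

/-- membership in M[[𝐳,𝐰]] -/
def IsPow2 (a : Dist2 K M) : Prop :=
  ∀ n k, a n k ≠ 0 →
    (IsNegInt K n.1 ∧ IsNegInt K n.2) ∧ (IsNegInt K k.1 ∧ IsNegInt K k.2)

/-- membership in M⌊𝐳,𝐰⌋ -/
def InLat2 (a : Dist2 K M) : Prop :=
  ∃ S : Finset (Idx K × Idx K), ∀ n k, a n k ≠ 0 →
    ∃ m ∈ S, (IsNegInt K (n.1 - m.1.1) ∧ IsNegInt K (n.2 - m.1.2)) ∧
      (IsNegInt K (k.1 - m.2.1) ∧ IsNegInt K (k.2 - m.2.2))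

/-- membership in M[[𝐳₁,…,𝐳ᵣ]] -/
def IsPowN {r : ℕ} (a : DistN K M r) : Prop :=
  ∀ n, a n ≠ 0 → ∀ i, IsNegInt K (n i).1 ∧ IsNegInt K (n i).2

/-- membership in M⌊𝐳₁,…,𝐳ᵣ⌋ -/
def InLatN {r : ℕ} (a : DistN K M r) : Prop :=
  ∃ S : Finset (Fin r → Idx K), ∀ n, a n ≠ 0 →
    ∃ m ∈ S, ∀ i, IsNegInt K ((n i).1 - (m i).1) ∧ IsNegInt K ((n i).2 - (m i).2)

/-- ∂_z -/
def dz (a : Dist1 K M) : Dist1 K M := fun n => (-n.1) • a (n.1 - 1, n.2)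

/-- ∂_z̄ -/
def dzb (a : Dist1 K M) : Dist1 K M := fun n => (-n.2) • a (n.1, n.2 - 1)

/-- ∂ in the first variable pair of a two-variable distribution (z-component) -/
def d1z (c : Dist2 K M) : Dist2 K M := fun n k => (-n.1) • c (n.1 - 1, n.2) k

/-- ∂ in the first variable pair of a two-variable distribution (z̄-component) -/
def d1zb (c : Dist2 K M) : Dist2 K M := fun n k => (-n.2) • c (n.1, n.2 - 1) k

/-- divided power d^{(x)} of an operator d, for a K-valued exponent x
(zero unless x ∈ ℕ) -/
def dPow {A : Type*} [AddCommGroup A] [Module K A] (d : A → A) (x : K) (a : A) : A :=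
  if h : ∃ j : ℕ, (j : K) = x then ((h.choose.factorial : K))⁻¹ • d^[h.choose] a else 0

/-- ∂_z^{(e_1)} ∂_z̄^{(e_2)} in the first variable pair -/
def ddPow2 (e : Idx K) (c : Dist2 K M) : Dist2 K M :=
  dPow K (d1z K M) e.1 (dPow K (d1zb K M) e.2 c)

/-- the diagonal map c(𝐳,𝐰) ↦ c(𝐰,𝐰) -/
def diag (c : Dist2 K M) : Dist1 K M :=
  fun n => ∑ᶠ m : Idx K, c m (n.1 - m.1 - 1, n.2 - m.2 - 1)

/-- multiplication by (𝐳−𝐰)^h (expansion in z>w), on coefficients;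
first index is 𝐳, second is 𝐰 -/
def zwPow (h : Idx K) (c : Dist2 K M) : Dist2 K M :=
  fun m k => ∑ᶠ i : ℕ × ℕ,
    ((-1 : K) ^ (i.1 + i.2) * gchoose K h.1 i.1 * gchoose K h.2 i.2) •
      c (m.1 + h.1 - i.1, m.2 + h.2 - i.2) (k.1 + i.1, k.2 + i.2)

/-- multiplication by ((𝐳−𝐰)_{w>z})^h = (−1)^h (𝐰−𝐳)^h (expansion in w>z) -/
def zwPowW (h : Idx K) (c : Dist2 K M) : Dist2 K M :=
  fun m k => ∑ᶠ i : ℕ × ℕ,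
    (negOnePow K (h.1 - h.2) * (-1 : K) ^ (i.1 + i.2) *
        gchoose K h.1 i.1 * gchoose K h.2 i.2) •
      c (m.1 + i.1, m.2 + i.2) (k.1 + h.1 - i.1, k.2 + h.2 - i.2)

/-- multiplication by (𝐱+𝐰)^N of a distribution d(𝐰,𝐱) (first index 𝐰, second 𝐱);
the result is indexed by (x-index, w-index) -/
def xwPow (N : Idx K) (d : Dist2 K M) : Dist2 K M :=
  fun m k => ∑ᶠ i : ℕ × ℕ, (gchoose K N.1 i.1 * gchoose K N.2 i.2) •
    d (k.1 + i.1, k.2 + i.2) (m.1 + N.1 - i.1, m.2 + N.2 - i.2)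

/-- multiplication by (𝐰+𝐱)^N of a distribution d(𝐰,𝐱) (first index 𝐰, second 𝐱);
the result is indexed by (x-index, w-index) -/
def wxPow (N : Idx K) (d : Dist2 K M) : Dist2 K M :=
  fun m k => ∑ᶠ i : ℕ × ℕ, (gchoose K N.1 i.1 * gchoose K N.2 i.2) •
    d (k.1 + N.1 - i.1, k.2 + N.2 - i.2) (m.1 + i.1, m.2 + i.2)

/-- multiplication by 𝐱^A 𝐰^B (𝐱+𝐰)^N of p(𝐰,𝐱); result indexed (x-index, w-index) -/
def tripleXW (A B N : Idx K) (p : Dist2 K M) : Dist2 K M :=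
  fun m k => ∑ᶠ l : ℕ × ℕ, (gchoose K N.1 l.1 * gchoose K N.2 l.2) •
    p (k.1 + B.1 + l.1, k.2 + B.2 + l.2) (m.1 + A.1 + N.1 - l.1, m.2 + A.2 + N.2 - l.2)

/-- multiplication by 𝐱^A 𝐰^B (𝐰+𝐱)^N of p(𝐰,𝐱); result indexed (x-index, w-index) -/
def tripleWX (A B N : Idx K) (p : Dist2 K M) : Dist2 K M :=
  fun m k => ∑ᶠ l : ℕ × ℕ, (gchoose K N.1 l.1 * gchoose K N.2 l.2) •
    p (k.1 + B.1 + N.1 - l.1, k.2 + B.2 + N.2 - l.2) (m.1 + A.1 + l.1, m.2 + A.2 + l.2)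

variable (E : Type*) [AddCommGroup E] [Module K E]

/-- End(E)-valued distributions in one variable pair -/
abbrev EDist1 := Dist1 K (Module.End K E)

/-- End(E)-valued distributions in two variable pairs -/
abbrev EDist2 := Dist2 K (Module.End K E)

/-- End(E)-valued distributions in r variable pairs -/
abbrev EDistN (r : ℕ) := DistN K (Module.End K E) r

def ev1 (a : EDist1 K E) (v : E) : Dist1 K E := fun n => a n v

def ev2 (c : EDist2 K E) (v : E) : Dist2 K E := fun n k => c n k v

def evN {r : ℕ} (c : EDistN K E r) (v : E) : DistN K E r := fun n => c n v

/-- a(𝐳) is a field -/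
def IsFieldD (a : EDist1 K E) : Prop := ∀ v, InLat1 K E (ev1 K E a v)

/-- a field in two variable pairs -/
def IsField2D (c : EDist2 K E) : Prop := ∀ v, InLat2 K E (ev2 K E c v)

/-- the Koszul sign (−1)^{pq} -/
def koszul (p q : ZMod 2) : K := if p = 1 ∧ q = 1 then (-1 : K) else 1

/-- the data (c^i, 𝐡_i) is an OPE of the homogeneous distributions a(𝐳), b(𝐳)
of parities pa, pb (all identities to be read applied to each vector of E) -/
def IsOPE (pa pb : ZMod 2) (a b : EDist1 K E) {r : ℕ}
    (c : Fin r → EDist2 K E) (h : Fin r → Idx K) : Prop :=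
  (∀ i, Kbar K (h i)) ∧ (∀ i, IsField2D K E (c i)) ∧
  (∀ v m k, a m (b k v) = ∑ i, zwPow K E (-(h i)) (ev2 K E (c i) v) m k) ∧
  (∀ v m k, koszul K pa pb • (b k (a m v)) =
      ∑ i, zwPowW K E (-(h i)) (ev2 K E (c i) v) m k)

/-- a(𝐳), b(𝐳) (homogeneous of parities pa, pb) are local -/
def IsLocal (pa pb : ZMod 2) (a b : EDist1 K E) : Prop :=
  ∃ (r : ℕ) (c : Fin r → EDist2 K E) (h : Fin r → Idx K), IsOPE K E pa pb a b c h

/-- the exponents of an OPE are reduced: 𝐡_i ∉ 𝐡_j + ℤ² for i ≠ j -/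
def ReducedExp {r : ℕ} (h : Fin r → Idx K) : Prop :=
  ∀ i j, i ≠ j → ¬ IsIntPair K (h i - h j)

/-- the product field a(𝐰)_{(𝐧)}b(𝐰) built from an OPE (c,h), applied to a vector v -/
def prodAt {r : ℕ} (c : Fin r → EDist2 K E) (h : Fin r → Idx K) (n : Idx K)
    (v : E) : Dist1 K E :=
  fun m => ∑ i, diag K E
    (ddPow2 K E ((h i).1 - 1 - n.1, (h i).2 - 1 - n.2) (ev2 K E (c i) v)) m

/-- s₁ : a(𝐳) ↦ a_{(−1,−1)}1 -/
def s1 (one : E) (a : EDist1 K E) : E := a ((-1 : K), (-1 : K)) one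

/-- the distribution d (to be thought of as a(𝐳)1) equals
Σ_{𝐢∈ℕ²} T^{(i)} T̄^{(ī)} (d_{(−1,−1)}) 𝐳^𝐢, i.e. a(𝐳) is creative -/
def CreativeD (T Tb : Module.End K E) (d : Dist1 K E) : Prop :=
  (∀ i : ℕ × ℕ, d (-(i.1 : K) - 1, -(i.2 : K) - 1) =
      ((i.1.factorial : K)⁻¹ * (i.2.factorial : K)⁻¹) •
        ((T ^ i.1) * (Tb ^ i.2)) (d ((-1 : K), (-1 : K)))) ∧
  (∀ n : Idx K, (¬ ∃ i : ℕ × ℕ, n = (-(i.1 : K) - 1, -(i.2 : K) - 1)) → d n = 0)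

/-- a(𝐳) is translation covariant for (T, T̄) -/
def TransCov (T Tb : Module.End K E) (a : EDist1 K E) : Prop :=
  (∀ n : Idx K, T * a n - a n * T = (-n.1) • a (n.1 - 1, n.2)) ∧
  (∀ n : Idx K, Tb * a n - a n * Tb = (-n.2) • a (n.1, n.2 - 1))

/-- translation covariance of a product field, per vector -/
def TransCovAt (T Tb : Module.End K E) (P : E → Dist1 K E) : Prop :=
  (∀ v (m : Idx K), T (P v m) - P (T v) m = (-m.1) • P v (m.1 - 1, m.2)) ∧
  (∀ v (m : Idx K), Tb (P v m) - P (Tb v) m = (-m.2) • P v (m.1, m.2 - 1))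

/-- the identity field 1(z) = id_E -/
def idField : EDist1 K E :=
  fun n => if n = ((-1 : K), (-1 : K)) then (1 : Module.End K E) else 0

/-- pairs i < j in [r] -/
abbrev Pairs (r : ℕ) := {p : Fin r × Fin r // p.1 < p.2}

/-- the index shift of the i-th variable produced by the monomial of a binomial
expansion of ((𝐳_{p₁} − 𝐳_{p₂})_σ)^h belonging to 𝐤 ∈ ℕ² -/
def pairShift {r : ℕ} (p : Pairs r) (h : Idx K) (flip : Bool) (kk : ℕ × ℕ)
    (i : Fin r) : Idx K :=
  if i = p.1.1 then
    (if flip then ((kk.1 : K), (kk.2 : K)) else (h.1 - kk.1, h.2 - kk.2))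
  else if i = p.1.2 then
    (if flip then (h.1 - kk.1, h.2 - kk.2) else ((kk.1 : K), (kk.2 : K)))
  else 0

/-- the coefficient of a binomial expansion of ((𝐳_{p₁} − 𝐳_{p₂})_σ)^h
belonging to 𝐤 ∈ ℕ² -/
def pairCoef (h : Idx K) (flip : Bool) (kk : ℕ × ℕ) : K :=
  (if flip then negOnePow K (h.1 - h.2) else 1) * (-1 : K) ^ (kk.1 + kk.2) *
    gchoose K h.1 kk.1 * gchoose K h.2 kk.2

def flipOf {r : ℕ} (σ : Equiv.Perm (Fin r)) (p : Pairs r) : Bool :=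
  decide (σ.symm p.1.2 < σ.symm p.1.1)

/-- multiplication by Π_{i<j} ((𝐳_i − 𝐳_j)_σ)^{h_{ij}} on an r-variable distribution -/
def permMul {r : ℕ} (σ : Equiv.Perm (Fin r)) (hs : Pairs r → Idx K)
    (c : DistN K M r) : DistN K M r :=
  fun m => ∑ᶠ κ : Pairs r → ℕ × ℕ,
    (∏ p : Pairs r, pairCoef K (hs p) (flipOf σ p) (κ p)) •
      c (fun i => m i + ∑ p : Pairs r, pairShift K p (hs p) (flipOf σ p) (κ p) i)

/-- the Koszul sign ζ' produced by reordering a¹,…,aʳ into a^{σ1},…,a^{σr} -/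
def koszulPerm {r : ℕ} (ps : Fin r → ZMod 2) (σ : Equiv.Perm (Fin r)) : K :=
  ∏ p : Pairs r,
    if σ.symm p.1.2 < σ.symm p.1.1 ∧ ps p.1.1 = 1 ∧ ps p.1.2 = 1 then (-1 : K) else 1

/-- the composition a^{σ1}(𝐳_{σ1})_{m_{σ1}} ∘ ⋯ ∘ a^{σr}(𝐳_{σr})_{m_{σr}} applied to v -/
def compSeq {r : ℕ} (a : Fin r → EDist1 K E) (σ : Equiv.Perm (Fin r))
    (m : Fin r → Idx K) (v : E) : E :=
  (List.ofFn fun j : Fin r => σ j).foldr (fun i acc => a i (m i) acc) v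

/-- the data (c^α, 𝐡_{ij}^k) is a (multiple) OPE of the homogeneous distributions
a¹(𝐳),…,aʳ(𝐳) of parities ps -/
def IsMultOPE {r : ℕ} (a : Fin r → EDist1 K E) (ps : Fin r → ZMod 2)
    (rij : Fin r → Fin r → ℕ) (hs : ∀ i j : Fin r, Fin (rij i j) → Idx K)
    (c : ((p : Pairs r) → Fin (rij p.1.1 p.1.2)) → EDistN K E r) : Prop :=
  (∀ i j k, Kbar K (hs i j k)) ∧
  (∀ α v, InLatN K E (evN K E (c α) v)) ∧
  (∀ σ : Equiv.Perm (Fin r), ∀ v m,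
    koszulPerm K ps σ • compSeq K E a σ m v =
      ∑ α : (p : Pairs r) → Fin (rij p.1.1 p.1.2),
        permMul K E σ (fun p => -(hs p.1.1 p.1.2 (α p))) (evN K E (c α) v) m)

/-- a¹(𝐳),…,aʳ(𝐳) are multiply local -/
def MultiplyLocal {r : ℕ} (a : Fin r → EDist1 K E) (ps : Fin r → ZMod 2) : Prop :=
  ∃ (rij : Fin r → Fin r → ℕ) (hs : ∀ i j : Fin r, Fin (rij i j) → Idx K)
    (c : ((p : Pairs r) → Fin (rij p.1.1 p.1.2)) → EDistN K E r),
      IsMultOPE K E a ps rij hs c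

/-- a set of homogeneous fields (with parities pF) is multiply local -/
def MultLocalSet (F : Set (EDist1 K E)) (pF : EDist1 K E → ZMod 2) : Prop :=
  ∀ (r : ℕ) (f : Fin r → EDist1 K E), (∀ i, f i ∈ F) →
    MultiplyLocal K E f (fun i => pF (f i))

/-- a set of homogeneous fields (with parities pF) is uniformly local -/
def UnifLocalSet (F : Set (EDist1 K E)) (pF : EDist1 K E → ZMod 2) (one : E) : Prop :=
  ∃ (rr : EDist1 K E → EDist1 K E → ℕ)
    (hh : ∀ d e : EDist1 K E, Fin (rr d e) → Idx K),
    ∀ (r : ℕ) (f : Fin r → EDist1 K E), (∀ i, f i ∈ F) →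
      ∃ c, IsMultOPE K E f (fun i => pF (f i)) (fun i j => rr (f i) (f j))
          (fun i j => hh (f i) (f j)) c ∧
        ∀ α, IsPowN K E (evN K E (c α) one)

/-- a ∈ V is homogeneous of parity p w.r.t. the grading (ev, od) -/
def memPar {V : Type*} [AddCommGroup V] [Module K V] (ev od : Submodule K V)
    (a : V) (p : ZMod 2) : Prop :=
  (p = 0 ∧ a ∈ ev) ∨ (p = 1 ∧ a ∈ od)

/-- an endomorphism is homogeneous of parity p w.r.t. the grading (ev, od) -/
def EndPar {V : Type*} [AddCommGroup V] [Module K V] (ev od : Submodule K V)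
    (f : Module.End K V) (p : ZMod 2) : Prop :=
  if p = 0 then (∀ v ∈ ev, f v ∈ ev) ∧ (∀ v ∈ od, f v ∈ od)
  else (∀ v ∈ ev, f v ∈ od) ∧ (∀ v ∈ od, f v ∈ ev)

/-- a distribution is homogeneous of parity p -/
def EDistPar {V : Type*} [AddCommGroup V] [Module K V] (ev od : Submodule K V)
    (a : EDist1 K V) (p : ZMod 2) : Prop :=
  ∀ n, EndPar K ev od (a n) p

end OPEA

namespace OPEA

/-- an OPE-algebra -/
structure OPEAlg (K : Type*) [Field K] [CharZero K]
    (V : Type*) [AddCommGroup V] [Module K V] where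
  ev : Submodule K V
  od : Submodule K V
  compl : IsCompl ev od
  Y : V →ₗ[K] EDist1 K V
  Y_par : ∀ a p, memPar K ev od a p → ∀ (n : Idx K) b q, memPar K ev od b q →
    memPar K ev od (Y a n b) (p + q)
  one : V
  one_ev : one ∈ ev
  T : Module.End K V
  Tb : Module.End K V
  T_ev : EndPar K ev od T 0
  Tb_ev : EndPar K ev od Tb 0
  commTTb : T * Tb = Tb * T
  T_one : T one = 0
  Tb_one : Tb one = 0
  wcre : ∀ a, IsPow1 K V (ev1 K V (Y a) one)
  rid : ∀ a, Y a ((-1 : K), (-1 : K)) one = a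
  tcov : ∀ a, TransCov K V T Tb (Y a)
  loc : ∀ a b pa pb, memPar K ev od a pa → memPar K ev od b pb →
    IsLocal K V pa pb (Y a) (Y b)

/-- a bounded 𝕂̄-fold algebra -/
structure BFold (K : Type*) [Field K] [CharZero K]
    (V : Type*) [AddCommGroup V] [Module K V] where
  ev : Submodule K V
  od : Submodule K V
  compl : IsCompl ev od
  Y : V →ₗ[K] EDist1 K V
  Y_par : ∀ a p, memPar K ev od a p → ∀ (n : Idx K) b q, memPar K ev od b q →
    memPar K ev od (Y a n b) (p + q)
  fields : ∀ a, IsFieldD K V (Y a)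
  bounded : ∀ a (n : Idx K), ¬ Kbar K n → ∀ b, Y a n b = 0

/-- a bounded 𝕂̄-fold module over a bounded 𝕂̄-fold algebra -/
structure BMod (K : Type*) [Field K] [CharZero K]
    (V : Type*) [AddCommGroup V] [Module K V] (A : BFold K V)
    (Mo : Type*) [AddCommGroup Mo] [Module K Mo] where
  evM : Submodule K Mo
  odM : Submodule K Mo
  complM : IsCompl evM odM
  YM : V →ₗ[K] EDist1 K Mo
  YM_par : ∀ a p, memPar K A.ev A.od a p → ∀ n : Idx K, EndPar K evM odM (YM a n) p
  fieldsM : ∀ a, IsFieldD K Mo (YM a)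
  boundedM : ∀ a (n : Idx K), ¬ Kbar K n → ∀ c, YM a n c = 0

variable (K : Type*) [Field K] [CharZero K]
variable (V : Type*) [AddCommGroup V] [Module K V]
variable (Mo : Type*) [AddCommGroup Mo] [Module K Mo]

/-- the operator T₁ : a ↦ a_{(−2,−1)}1 of an OPE-algebra -/
def T1 (A : OPEAlg K V) : Module.End K V where
  toFun := fun a => A.Y a ((-2 : K), (-1 : K)) A.one
  map_add' := by
    intro x y
    simp [map_add, Pi.add_apply, LinearMap.add_apply]
  map_smul' := by
    intro c x
    simp [map_smul, Pi.smul_apply, LinearMap.smul_apply]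

/-- the operator T̄₁ : a ↦ a_{(−1,−2)}1 of an OPE-algebra -/
def T1b (A : OPEAlg K V) : Module.End K V where
  toFun := fun a => A.Y a ((-1 : K), (-2 : K)) A.one
  map_add' := by
    intro x y
    simp [map_add, Pi.add_apply, LinearMap.add_apply]
  map_smul' := by
    intro c x
    simp [map_smul, Pi.smul_apply, LinearMap.smul_apply]

/-- skew-symmetry for the pair (T, T̄) -/
def SkewSym (ev od : Submodule K V) (Yf : V → EDist1 K V)
    (T Tb : Module.End K V) : Prop :=
  ∀ a b pa pb, memPar K ev od a pa → memPar K ev od b pb →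
    ∀ n : Idx K, Kbar K n →
      (Function.support (fun i : ℕ × ℕ =>
        ((i.1.factorial : K)⁻¹ * (i.2.factorial : K)⁻¹ *
            negOnePow K (n.1 + i.1 - (n.2 + i.2))) •
          ((T ^ i.1) * (Tb ^ i.2)) (Yf a (n.1 + i.1, n.2 + i.2) b))).Finite ∧
      koszul K pa pb • Yf b n a =
        ∑ᶠ i : ℕ × ℕ, ((i.1.factorial : K)⁻¹ * (i.2.factorial : K)⁻¹ *
            negOnePow K (n.1 + i.1 - (n.2 + i.2))) •
          ((T ^ i.1) * (Tb ^ i.2)) (Yf a (n.1 + i.1, n.2 + i.2) b)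

/-- (T, T̄) is a translation endomorphism of the module with state-field map YM -/
def TransEnd (YM : V → EDist1 K Mo) (T Tb : Module.End K V) : Prop :=
  (∀ a (n : Idx K), YM (T a) n = (-n.1) • YM a (n.1 - 1, n.2)) ∧
  (∀ a (n : Idx K), YM (Tb a) n = (-n.2) • YM a (n.1, n.2 - 1))

/-- the coefficient at (x-index m, w-index k) of a(𝐱+𝐰) applied to the w-distribution bw -/
def lhsXW (YM : V → EDist1 K Mo) (a : V) (bw : Dist1 K Mo) (m k : Idx K) : Mo :=
  ∑ᶠ i : ℕ × ℕ, ((i.1.factorial : K)⁻¹ * (i.2.factorial : K)⁻¹) •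
    (((dz K (Module.End K Mo))^[i.1] ((dzb K (Module.End K Mo))^[i.2] (YM a))) m)
      (bw (k.1 + i.1, k.2 + i.2))

/-- a and cM are dual in the direct channel -/
def DualDirect (Y : V → EDist1 K V) (YM : V → EDist1 K Mo) (a : V) (cM : Mo) : Prop :=
  ∃ (s : ℕ) (d : Fin s → Idx K → Idx K → (V →ₗ[K] Mo)) (hj : Fin s → Idx K),
    (∀ j, Kbar K (hj j)) ∧
    (∀ j b, InLat2 K Mo (fun kw mx => d j kw mx b)) ∧
    (∀ b (m k : Idx K),
      lhsXW K V Mo YM a (fun k' => YM b k' cM) m k =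
        ∑ j, xwPow K Mo (-(hj j)) (fun kw mx => d j kw mx b) m k) ∧
    (∀ b (m k : Idx K),
      YM (Y a m b) k cM =
        ∑ j, wxPow K Mo (-(hj j)) (fun kw mx => d j kw mx b) m k)

/-- a and b are dual in the exchange channel on the module -/
def DualExch (Y : V → EDist1 K V) (YM : V → EDist1 K Mo) (a b : V) : Prop :=
  ∃ (r : ℕ) (hab : Fin r → Idx K), (∀ i, Kbar K (hab i)) ∧
    ∀ cM : Mo, ∃ (s : ℕ) (hac : Fin s → Idx K)
      (q : Fin r → Fin s → Idx K → Idx K → Mo),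
      (∀ j, Kbar K (hac j)) ∧
      (∀ i j kw mx, q i j kw mx ≠ 0 → IsNegInt K mx.1 ∧ IsNegInt K mx.2) ∧
      (∀ i j mx, InLat1 K Mo (fun kw => q i j kw mx)) ∧
      (∀ m k : Idx K,
        lhsXW K V Mo YM a (fun k' => YM b k' cM) m k =
          ∑ j, xwPow K Mo (-(hac j))
            (fun kw mx => ∑ i, q i j kw (mx.1 - (hab i).1, mx.2 - (hab i).2)) m k) ∧
      (∀ m k : Idx K,
        YM (Y a m b) k cM =
          ∑ j, wxPow K Mo (-(hac j))
            (fun kw mx => ∑ i, q i j kw (mx.1 - (hab i).1, mx.2 - (hab i).2)) m k)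

/-- the module with state-field map YM is dual -/
def IsDualMod (ev od : Submodule K V) (Y : V → EDist1 K V) (YM : V → EDist1 K Mo) : Prop :=
  ∃ (rVV : V → V → ℕ) (hVV : ∀ a b : V, Fin (rVV a b) → Idx K)
    (rVM : V → Mo → ℕ) (hVM : ∀ (a : V) (c : Mo), Fin (rVM a c) → Idx K),
    (∀ a b i, Kbar K (hVV a b i)) ∧ (∀ a c j, Kbar K (hVM a c j)) ∧
    ∀ a b pa pb, memPar K ev od a pa → memPar K ev od b pb → ∀ c : Mo,
      ∃ p : Fin (rVV a b) → Fin (rVM a c) → Fin (rVM b c) → Dist2 K Mo,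
        (∀ i j k, IsPow2 K Mo (p i j k)) ∧
        (∀ m k : Idx K,
          lhsXW K V Mo YM a (fun k' => YM b k' c) m k =
            ∑ i, ∑ j, ∑ kk, tripleXW K Mo (-(hVV a b i)) (-(hVM b c kk))
              (-(hVM a c j)) (p i j kk) m k) ∧
        (∀ m k : Idx K,
          YM (Y a m b) k c =
            ∑ i, ∑ j, ∑ kk, tripleWX K Mo (-(hVV a b i)) (-(hVM b c kk))
              (-(hVM a c j)) (p i j kk) m k)

/-- F_Y is multiply local -/
def MultLocalAlg (A : OPEAlg K V) : Prop :=
  ∀ (r : ℕ) (f : Fin r → V) (pf : Fin r → ZMod 2),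
    (∀ i, memPar K A.ev A.od (f i) (pf i)) →
      MultiplyLocal K V (fun i => A.Y (f i)) pf

/-- F_Y is uniformly local -/
def UnifLocalAlg (A : OPEAlg K V) : Prop :=
  ∃ (rr : V → V → ℕ) (hh : ∀ a b : V, Fin (rr a b) → Idx K),
    ∀ (r : ℕ) (f : Fin r → V) (pf : Fin r → ZMod 2),
      (∀ i, memPar K A.ev A.od (f i) (pf i)) →
        ∃ c, IsMultOPE K V (fun i => A.Y (f i)) pf (fun i j => rr (f i) (f j))
            (fun i j => hh (f i) (f j)) c ∧
          ∀ α, IsPowN K V (evN K V (c α) A.one)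

end OPEA
namespace OPEA

section FinitePairSums

variable {M : Type*} [AddCommGroup M]

/-- the pairs of elements of ℕ² with a given sum -/
def pairAntidiagonal (n : ℕ × ℕ) : Finset ((ℕ × ℕ) × (ℕ × ℕ)) :=
  (Finset.HasAntidiagonal.antidiagonal n.1 ×ˢ Finset.HasAntidiagonal.antidiagonal n.2).map
    (Equiv.prodProdProdComm ℕ ℕ ℕ ℕ).toEmbedding

lemma mem_pairAntidiagonal {n : ℕ × ℕ} {q : (ℕ × ℕ) × (ℕ × ℕ)} :
    q ∈ pairAntidiagonal n ↔ q.1 + q.2 = n := by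
  obtain ⟨⟨a, b⟩, ⟨c, d⟩⟩ := q
  obtain ⟨e, f⟩ := n
  simp [pairAntidiagonal, Equiv.prodProdProdComm]

lemma finite_setOf_add_mem {F : Set (ℕ × ℕ)} (hF : F.Finite) :
    {q : (ℕ × ℕ) × (ℕ × ℕ) | q.1 + q.2 ∈ F}.Finite := by
  refine (hF.biUnion fun n _ => (pairAntidiagonal n).finite_toSet).subset fun q hq => ?_
  simp only [Set.mem_iUnion]
  exact ⟨_, hq, mem_pairAntidiagonal.2 rfl⟩

lemma finsum_finsum_eq_finsum_antidiagonal (f : ℕ × ℕ → ℕ × ℕ → M)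
    (hf : {q : (ℕ × ℕ) × (ℕ × ℕ) | f q.1 q.2 ≠ 0}.Finite) :
    ∑ᶠ i, ∑ᶠ j, f i j = ∑ᶠ n, ∑ q ∈ pairAntidiagonal n, f q.1 q.2 := by
  have h1 : ∑ᶠ q : (ℕ × ℕ) × (ℕ × ℕ), f q.1 q.2 = ∑ᶠ i, ∑ᶠ j, f i j :=
    finsum_curry (fun q : (ℕ × ℕ) × (ℕ × ℕ) => f q.1 q.2) hf
  have hmem : ∀ q : (ℕ × ℕ) × (ℕ × ℕ), q ∈ hf.toFinset ↔ f q.1 q.2 ≠ 0 := by simp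
  rw [← h1, finsum_eq_sum_of_support_subset (s := hf.toFinset) _ (by intro q hq; simpa using hq),
    finsum_eq_sum_of_support_subset (s := hf.toFinset.image fun q => q.1 + q.2),
    ← Finset.sum_fiberwise_of_maps_to (g := fun q : (ℕ × ℕ) × (ℕ × ℕ) => q.1 + q.2)
      (t := hf.toFinset.image fun q => q.1 + q.2)
      (fun q hq => Finset.mem_image_of_mem _ hq)]
  · refine Finset.sum_congr rfl fun n _ => ?_
    refine Finset.sum_subset (fun q hq => ?_) fun q hq hq' => ?_
    · exact mem_pairAntidiagonal.2 (Finset.mem_filter.1 hq).2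
    · by_contra h
      exact hq' (Finset.mem_filter.2 ⟨(hmem q).2 h, mem_pairAntidiagonal.1 hq⟩)
  · intro n hn
    obtain ⟨q, hq, hq0⟩ := Finset.exists_ne_zero_of_sum_ne_zero hn
    exact Finset.mem_coe.2 (Finset.mem_image.2
      ⟨q, (hmem q).2 hq0, mem_pairAntidiagonal.1 hq⟩)

lemma finsum_finsum_comm {α β : Type*} (f : α → β → M)
    (hf : {q : α × β | f q.1 q.2 ≠ 0}.Finite) :
    ∑ᶠ i, ∑ᶠ j, f i j = ∑ᶠ j, ∑ᶠ i, f i j := by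
  have hf' : {q : β × α | f q.2 q.1 ≠ 0}.Finite :=
    (hf.preimage (Prod.swap_injective.injOn)).subset fun q hq => hq
  have h1 := finsum_curry (fun q : α × β => f q.1 q.2) hf
  have h2 := finsum_curry (fun q : β × α => f q.2 q.1) hf'
  simp only at h1 h2
  rw [← h1, ← h2]
  exact (finsum_comp_equiv (Equiv.prodComm β α)).symm

lemma finite_support_finsum {α β : Type*} (f : α → β → M)
    (hf : {q : α × β | f q.1 q.2 ≠ 0}.Finite) : {j | ∑ᶠ i, f i j ≠ 0}.Finite := by
  refine (hf.image Prod.snd).subset fun j hj => ?_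
  by_contra h
  refine hj (finsum_eq_zero_of_forall_eq_zero fun i => ?_)
  by_contra hi
  exact h ⟨(i, j), hi, rfl⟩

end FinitePairSums

section DividedPowers

variable (K : Type*) [Field K]

/-- the product X^{(p)} Y^{(p̄)} of divided powers -/
def divPow {R : Type*} [Ring R] [Algebra K R] (X Y : R) (p : ℕ × ℕ) : R :=
  ((p.1.factorial : K)⁻¹ * (p.2.factorial : K)⁻¹) • (X ^ p.1 * Y ^ p.2)

variable {K} {R : Type*} [Ring R] [Algebra K R]

@[simp]
lemma divPow_zero (X Y : R) : divPow K X Y 0 = 1 := by simp [divPow]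

lemma divPow_zero_zero (p : ℕ × ℕ) : divPow K (0 : R) 0 p = if p = 0 then 1 else 0 := by
  obtain ⟨i, j⟩ := p
  rcases i with _ | i <;> rcases j with _ | j <;> simp [divPow]

lemma inv_factorial_smul_add_pow [CharZero K] {X Y : R} (h : Commute X Y) (n : ℕ) :
    (n.factorial : K)⁻¹ • (X + Y) ^ n = ∑ q ∈ Finset.HasAntidiagonal.antidiagonal n,
      ((q.1.factorial : K)⁻¹ • X ^ q.1) * ((q.2.factorial : K)⁻¹ • Y ^ q.2) := by
  rw [h.add_pow', Finset.smul_sum]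
  refine Finset.sum_congr rfl fun q hq => ?_
  have hq' := Finset.HasAntidiagonal.mem_antidiagonal.1 hq
  have hfac := Nat.add_choose_mul_factorial_mul_factorial q.2 q.1
  rw [add_comm, hq'] at hfac
  have hK : (n.choose q.1 : K) * q.2.factorial * q.1.factorial = n.factorial := by
    exact_mod_cast hfac
  have h1 : (q.1.factorial : K) ≠ 0 := by exact_mod_cast q.1.factorial_ne_zero
  have h2 : (q.2.factorial : K) ≠ 0 := by exact_mod_cast q.2.factorial_ne_zero
  have h3 : (n.factorial : K) ≠ 0 := by exact_mod_cast n.factorial_ne_zero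
  rw [← Nat.cast_smul_eq_nsmul K, smul_smul, smul_mul_smul_comm]
  congr 1
  field_simp
  linear_combination hK

lemma divPow_add [CharZero K] {X X' Y Y' : R} (hX : Commute X X') (hY : Commute Y Y')
    (h : Commute X' Y) (n : ℕ × ℕ) :
    divPow K (X + X') (Y + Y') n =
      ∑ q ∈ pairAntidiagonal n, divPow K X Y q.1 * divPow K X' Y' q.2 := by
  rw [divPow, ← smul_mul_smul_comm, inv_factorial_smul_add_pow hX, inv_factorial_smul_add_pow hY,
    Finset.sum_mul_sum, ← Finset.sum_product', pairAntidiagonal, Finset.sum_map]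
  refine Finset.sum_congr rfl fun x _ => ?_
  obtain ⟨⟨a, b⟩, ⟨c, d⟩⟩ := x
  have := (h.pow_pow b c).eq
  simp only [divPow, Equiv.prodProdProdComm, Equiv.coe_toEmbedding, Equiv.coe_fn_mk,
    smul_mul_smul_comm]
  rw [show X ^ a * X' ^ b * (Y ^ c * Y' ^ d) = X ^ a * Y ^ c * (X' ^ b * Y' ^ d) by
    simp only [mul_assoc]; rw [← mul_assoc (X' ^ b), this, mul_assoc]]
  congr 1
  ring

end DividedPowers

section ExpShift

variable {K : Type*} [Field K] {V : Type*} [AddCommGroup V]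

/-- the image of an element of ℕ² in K² -/
def natIdx (p : ℕ × ℕ) : Idx K := (p.1, p.2)

lemma natIdx_add (p q : ℕ × ℕ) : (natIdx (p + q) : Idx K) = natIdx p + natIdx q := by
  simp [natIdx]

@[simp]
lemma natIdx_zero : (natIdx 0 : Idx K) = 0 := by simp [natIdx]

/-- on every coset of ℤ², only finitely many nonzero coefficients above a given index -/
def UpperFinite (B : Idx K → V) : Prop := ∀ k, {p : ℕ × ℕ | B (k + natIdx p) ≠ 0}.Finite

lemma UpperFinite.of_zero {W : Type*} [AddCommGroup W] {B : Idx K → V} {B' : Idx K → W}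
    (hB : UpperFinite B) (h : ∀ k, B k = 0 → B' k = 0) : UpperFinite B' :=
  fun k => (hB k).subset fun _ hp hp' => hp (h _ hp')

lemma UpperFinite.finite_double {B : Idx K → V} (hB : UpperFinite B) (k : Idx K) :
    {q : (ℕ × ℕ) × (ℕ × ℕ) | B (k + natIdx (q.1 + q.2)) ≠ 0}.Finite :=
  finite_setOf_add_mem (hB k)

variable [Module K V]

/-- the action of e^{𝐰𝐓} on a distribution in 𝐰 -/
def expShift (T Tb : Module.End K V) (B : Idx K → V) : Idx K → V :=
  fun k => ∑ᶠ p : ℕ × ℕ, divPow K T Tb p (B (k + natIdx p))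

variable {T Tb : Module.End K V}

lemma UpperFinite.finite_support {B : Idx K → V} (hB : UpperFinite B) (k : Idx K) :
    Function.HasFiniteSupport fun p : ℕ × ℕ => divPow K T Tb p (B (k + natIdx p)) :=
  (hB k).subset fun p hp h => hp (by simp [h])

lemma expShift_add {B B' : Idx K → V} (hB : UpperFinite B) (hB' : UpperFinite B') (k : Idx K) :
    expShift T Tb (fun k => B k + B' k) k = expShift T Tb B k + expShift T Tb B' k := by
  simp only [expShift, map_add]
  exact finsum_add_distrib (hB.finite_support k) (hB'.finite_support k)

lemma expShift_smul (x : K) (B : Idx K → V) (k : Idx K) :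
    expShift T Tb (fun k => x • B k) k = x • expShift T Tb B k := by
  simp only [expShift, map_smul, smul_finsum]

lemma expShift_sum {ι : Type*} (s : Finset ι) {B : ι → Idx K → V}
    (hB : ∀ i, UpperFinite (B i)) (k : Idx K) :
    expShift T Tb (fun k => ∑ i ∈ s, B i k) k = ∑ i ∈ s, expShift T Tb (B i) k := by
  simp only [expShift, map_sum]
  exact finsum_sum_comm s _ fun i _ => (hB i).finite_support k

lemma expShift_finsum {ι : Type*} (G : ι → Idx K → V) (k : Idx K)
    (hG : {q : ι × (ℕ × ℕ) | G q.1 (k + natIdx q.2) ≠ 0}.Finite) :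
    expShift T Tb (fun k => ∑ᶠ i, G i k) k = ∑ᶠ i, expShift T Tb (G i) k := by
  simp only [expShift]
  rw [finsum_finsum_comm]
  · refine finsum_congr fun p => ?_
    refine map_finsum (divPow K T Tb p) ?_
    exact (hG.preimage (f := fun i => (i, p))
      fun i _ j _ h => (Prod.ext_iff.1 h).1).subset fun i hi => hi
  · exact hG.subset fun q hq h => hq (by rw [h, map_zero])

lemma apply_expShift {W : Type*} [AddCommGroup W] [Module K W] (f : V →ₗ[K] W)
    {B : Idx K → V} (hB : UpperFinite B) (k : Idx K) :
    f (expShift T Tb B k) = ∑ᶠ p : ℕ × ℕ, f (divPow K T Tb p (B (k + natIdx p))) :=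
  map_finsum f (hB.finite_support k)

lemma expShift_neg_expShift [CharZero K] (hcomm : T * Tb = Tb * T) {B : Idx K → V}
    (hB : UpperFinite B) (k : Idx K) :
    expShift (-T) (-Tb) (expShift T Tb B) k = B k := by
  have h1 : expShift (-T) (-Tb) (expShift T Tb B) k =
      ∑ᶠ i, ∑ᶠ j, (divPow K (-T) (-Tb) i * divPow K T Tb j) (B (k + natIdx (i + j))) := by
    rw [expShift]
    refine finsum_congr fun i => ?_
    rw [apply_expShift _ hB]
    refine finsum_congr fun j => ?_
    rw [natIdx_add, add_assoc]
    rfl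
  rw [h1, finsum_finsum_eq_finsum_antidiagonal, finsum_eq_single _ 0]
  · rw [pairAntidiagonal]
    simp [← Prod.zero_eq_mk]
  · intro n hn
    rw [Finset.sum_congr rfl fun q hq => by rw [mem_pairAntidiagonal.1 hq],
      ← LinearMap.sum_apply, ← divPow_add, neg_add_cancel, neg_add_cancel, divPow_zero_zero,
      if_neg hn, LinearMap.zero_apply]
    · exact (Commute.refl T).neg_left
    · exact (Commute.refl Tb).neg_left
    · exact Commute.neg_right hcomm
  · exact (hB.finite_double k).subset fun q hq h => hq (by rw [h, map_zero])

lemma divPow_mul_eq_sum [CharZero K] (hcomm : T * Tb = Tb * T) (x : Module.End K V)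
    (n : ℕ × ℕ) :
    divPow K T Tb n * x = ∑ q ∈ pairAntidiagonal n,
      divPow K (LinearMap.mulLeft K T - LinearMap.mulRight K T)
        (LinearMap.mulLeft K Tb - LinearMap.mulRight K Tb) q.2 x * divPow K T Tb q.1 := by
  have hR : Commute (LinearMap.mulRight K T) (LinearMap.mulRight K Tb) := by
    ext1 y
    simp only [Module.End.mul_apply, LinearMap.mulRight_apply, mul_assoc, hcomm]
  have hR' : ∀ (y : Module.End K V) p,
      divPow K (LinearMap.mulRight K T) (LinearMap.mulRight K Tb) p y = y * divPow K T Tb p := by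
    intro y p
    have hp := (Commute.pow_pow hcomm p.1 p.2).eq
    simp only [divPow, LinearMap.pow_mulRight, LinearMap.smul_apply, Module.End.mul_apply,
      LinearMap.mulRight_apply, mul_smul_comm, mul_assoc, hp]
  have hL : divPow K (LinearMap.mulLeft K T) (LinearMap.mulLeft K Tb) n x =
      divPow K T Tb n * x := by
    simp only [divPow, LinearMap.pow_mulLeft, LinearMap.smul_apply, Module.End.mul_apply,
      LinearMap.mulLeft_apply, smul_mul_assoc, mul_assoc]
  rw [← hL, ← add_sub_cancel (LinearMap.mulRight K T) (LinearMap.mulLeft K T),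
    ← add_sub_cancel (LinearMap.mulRight K Tb) (LinearMap.mulLeft K Tb), divPow_add,
    LinearMap.sum_apply]
  · simp only [add_sub_cancel, Module.End.mul_apply, hR']
  · exact (LinearMap.commute_mulLeft_right T T).symm.sub_right (Commute.refl _)
  · exact (LinearMap.commute_mulLeft_right Tb Tb).symm.sub_right (Commute.refl _)
  · exact (LinearMap.commute_mulLeft_right T Tb).sub_left hR

end ExpShift

section Translation

variable {K : Type*} [Field K] {V : Type*} [AddCommGroup V] [Module K V]
  {T Tb : Module.End K V}

lemma commute_mulLeft_sub_mulRight (hcomm : T * Tb = Tb * T) :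
    Commute (LinearMap.mulLeft K T - LinearMap.mulRight K T)
      (LinearMap.mulLeft K Tb - LinearMap.mulRight K Tb) := by
  refine Commute.sub_left (.sub_right ?_ (LinearMap.commute_mulLeft_right T Tb))
    (.sub_right (LinearMap.commute_mulLeft_right Tb T).symm ?_)
  · ext1 y
    simp only [Module.End.mul_apply, LinearMap.mulLeft_apply, ← mul_assoc, hcomm]
  · ext1 y
    simp only [Module.End.mul_apply, LinearMap.mulRight_apply, mul_assoc, hcomm]

lemma TransCov.iterate_dz_comp {a : EDist1 K V} (ha : TransCov K V T Tb a)
    (L : Module.End K (Module.End K V)) (n : ℕ) :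
    (dz K (Module.End K V))^[n] (fun m => L (a m)) =
      fun m => (L * (LinearMap.mulLeft K T - LinearMap.mulRight K T) ^ n) (a m) := by
  induction n with
  | zero => rfl
  | succ n ih =>
    funext m
    rw [Function.iterate_succ_apply', ih, pow_succ, ← mul_assoc, Module.End.mul_apply (_ * _),
      LinearMap.sub_apply, LinearMap.mulLeft_apply, LinearMap.mulRight_apply, ha.1, map_smul]
    rfl

lemma TransCov.iterate_dzb {a : EDist1 K V} (ha : TransCov K V T Tb a) (n : ℕ) :
    (dzb K (Module.End K V))^[n] a =
      fun m => ((LinearMap.mulLeft K Tb - LinearMap.mulRight K Tb) ^ n) (a m) := by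
  induction n with
  | zero => rfl
  | succ n ih =>
    funext m
    rw [Function.iterate_succ_apply', ih, pow_succ, Module.End.mul_apply,
      LinearMap.sub_apply, LinearMap.mulLeft_apply, LinearMap.mulRight_apply, ha.2, map_smul]
    rfl

lemma TransCov.iterate_dz_dzb {a : EDist1 K V} (ha : TransCov K V T Tb a)
    (hcomm : T * Tb = Tb * T) (i j : ℕ) (m : Idx K) :
    ((dz K (Module.End K V))^[i] ((dzb K (Module.End K V))^[j] a)) m =
      ((LinearMap.mulLeft K T - LinearMap.mulRight K T) ^ i *
        (LinearMap.mulLeft K Tb - LinearMap.mulRight K Tb) ^ j) (a m) := by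
  rw [ha.iterate_dzb, ha.iterate_dz_comp, ((commute_mulLeft_sub_mulRight hcomm).pow_pow i j).eq]

lemma lhsXW_expShift [CharZero K] {Y : V → EDist1 K V} {a : V} (ha : TransCov K V T Tb (Y a))
    (hcomm : T * Tb = Tb * T) {B : Idx K → V} (hB : UpperFinite B) (m k : Idx K) :
    lhsXW K V V Y a (expShift T Tb B) m k = expShift T Tb (fun k => Y a m (B k)) k := by
  have hfin : {q : (ℕ × ℕ) × (ℕ × ℕ) |
      (divPow K (LinearMap.mulLeft K T - LinearMap.mulRight K T)
        (LinearMap.mulLeft K Tb - LinearMap.mulRight K Tb) q.2 (Y a m) * divPow K T Tb q.1)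
        (B (k + natIdx (q.1 + q.2))) ≠ 0}.Finite :=
    (hB.finite_double k).subset fun q hq h => hq (by rw [h, map_zero])
  have hR : expShift T Tb (fun k => Y a m (B k)) k = ∑ᶠ n, ∑ q ∈ pairAntidiagonal n,
      (divPow K (LinearMap.mulLeft K T - LinearMap.mulRight K T)
        (LinearMap.mulLeft K Tb - LinearMap.mulRight K Tb) q.2 (Y a m) * divPow K T Tb q.1)
        (B (k + natIdx (q.1 + q.2))) := by
    refine finsum_congr fun n => ?_
    rw [← Module.End.mul_apply, divPow_mul_eq_sum hcomm, LinearMap.sum_apply]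
    exact Finset.sum_congr rfl fun q hq => by rw [mem_pairAntidiagonal.1 hq]
  rw [hR, ← finsum_finsum_eq_finsum_antidiagonal (fun i j =>
    (divPow K (LinearMap.mulLeft K T - LinearMap.mulRight K T)
        (LinearMap.mulLeft K Tb - LinearMap.mulRight K Tb) j (Y a m) * divPow K T Tb i)
        (B (k + natIdx (i + j)))) hfin, finsum_finsum_comm _ hfin, lhsXW]
  refine finsum_congr fun j => ?_
  rw [ha.iterate_dz_dzb hcomm]
  change (divPow K (LinearMap.mulLeft K T - LinearMap.mulRight K T)
    (LinearMap.mulLeft K Tb - LinearMap.mulRight K Tb) j (Y a m)) (expShift T Tb B (k + natIdx j)) = _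
  rw [apply_expShift _ hB]
  refine finsum_congr fun i => ?_
  rw [add_comm i j, natIdx_add, ← add_assoc]
  rfl

end Translation

section Coefficients

variable {K : Type*} [Field K] {V : Type*} [AddCommGroup V] [Module K V]

lemma xwPow_apply (N : Idx K) (d : Dist2 K V) (m k : Idx K) :
    xwPow K V N d m k = ∑ᶠ i : ℕ × ℕ, (gchoose K N.1 i.1 * gchoose K N.2 i.2) •
      d (k + natIdx i) (m + N - natIdx i) := rfl

lemma wxPow_apply (N : Idx K) (d : Dist2 K V) (m k : Idx K) :
    wxPow K V N d m k = ∑ᶠ i : ℕ × ℕ, (gchoose K N.1 i.1 * gchoose K N.2 i.2) •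
      d (k + N - natIdx i) (m + natIdx i) := rfl

lemma zwPow_apply (N : Idx K) (c : Dist2 K V) (m k : Idx K) :
    zwPow K V N c m k = ∑ᶠ i : ℕ × ℕ,
      ((-1 : K) ^ (i.1 + i.2) * gchoose K N.1 i.1 * gchoose K N.2 i.2) •
        c (m + N - natIdx i) (k + natIdx i) := rfl

lemma zwPowW_apply (N : Idx K) (c : Dist2 K V) (m k : Idx K) :
    zwPowW K V N c m k = ∑ᶠ i : ℕ × ℕ,
      (negOnePow K (N.1 - N.2) * (-1 : K) ^ (i.1 + i.2) * gchoose K N.1 i.1 *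
        gchoose K N.2 i.2) • c (m + natIdx i) (k + N - natIdx i) := rfl

end Coefficients

section Lattice

variable {K : Type*} [Field K]

/-- both components of an index pair are negative integers -/
def IsNegIntPair (x : Idx K) : Prop := IsNegInt K x.1 ∧ IsNegInt K x.2

lemma IsNegInt.of_add_natCast {x : K} {n : ℕ} (h : IsNegInt K (x + n)) : IsNegInt K x := by
  obtain ⟨j, hj, hx⟩ := h
  exact ⟨j - n, by omega, by push_cast; rw [hx]; ring⟩

lemma IsNegIntPair.of_add_natIdx {x : Idx K} {p : ℕ × ℕ} (h : IsNegIntPair (x + natIdx p)) :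
    IsNegIntPair x :=
  ⟨h.1.of_add_natCast, h.2.of_add_natCast⟩

lemma finite_isNegInt_add_natCast [CharZero K] (x : K) : {n : ℕ | IsNegInt K (x + n)}.Finite := by
  by_cases h : ∃ j : ℤ, (j : K) = x
  · obtain ⟨j, rfl⟩ := h
    refine (Set.finite_Iio (-j).toNat).subset fun n hn => ?_
    obtain ⟨l, hl, hln⟩ := hn
    have : l = j + n := by exact_mod_cast hln
    simp only [Set.mem_Iio]
    omega
  · convert Set.finite_empty
    ext n
    simp only [Set.mem_ofPred_eq, Set.mem_empty_iff_false, iff_false]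
    rintro hn
    obtain ⟨j, -, hj⟩ := hn.of_add_natCast
    exact h ⟨j, hj⟩

lemma finite_isNegIntPair_add_natIdx [CharZero K] (x : Idx K) :
    {p : ℕ × ℕ | IsNegIntPair (x + natIdx p)}.Finite :=
  ((finite_isNegInt_add_natCast x.1).prod (finite_isNegInt_add_natCast x.2)).subset
    fun _ hp => hp

variable {V : Type*} [AddCommGroup V]

lemma InLat2.flip {c : Dist2 K V} (hc : InLat2 K V c) : InLat2 K V (fun k m => c m k) := by
  obtain ⟨S, hS⟩ := hc
  refine ⟨S.image Prod.swap, fun k m h => ?_⟩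
  obtain ⟨s, hs, h1, h2⟩ := hS m k h
  exact ⟨s.swap, Finset.mem_image_of_mem _ hs, h2, h1⟩

lemma InLat2.of_zero {W : Type*} [AddCommGroup W] {c : Dist2 K V} {c' : Dist2 K W}
    (hc : InLat2 K V c) (h : ∀ k m, c k m = 0 → c' k m = 0) : InLat2 K W c' := by
  obtain ⟨S, hS⟩ := hc
  exact ⟨S, fun k m hkm => hS k m fun h0 => hkm (h k m h0)⟩

section

variable [Module K V]

lemma InLat2.expShift {d : Dist2 K V} (hd : InLat2 K V d) (T Tb : Module.End K V) :
    InLat2 K V fun k m => expShift T Tb (fun k => d k m) k := by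
  obtain ⟨S, hS⟩ := hd
  refine ⟨S, fun k m hkm => ?_⟩
  by_contra hne
  refine hkm (finsum_eq_zero_of_forall_eq_zero fun p => ?_)
  by_contra hp
  obtain ⟨s, hs, h1, h2⟩ := hS (k + natIdx p) m fun h => hp (by simp only [h, map_zero])
  refine hne ⟨s, hs, ?_, h2⟩
  refine IsNegIntPair.of_add_natIdx (x := k - s.1) (p := p) ?_
  rw [sub_add_eq_add_sub]
  exact h1

end

variable [CharZero K]

lemma InLat1.upperFinite {B : Dist1 K V} (hB : InLat1 K V B) : UpperFinite B := by
  obtain ⟨S, hS⟩ := hB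
  intro k
  refine (S.finite_toSet.biUnion fun s _ => finite_isNegIntPair_add_natIdx (k - s)).subset
    fun p hp => ?_
  obtain ⟨s, hs, h⟩ := hS _ hp
  refine Set.mem_biUnion hs ?_
  rw [Set.mem_ofPred_eq, sub_add_eq_add_sub]
  exact h

lemma InLat2.upperFinite {d : Dist2 K V} (hd : InLat2 K V d) (m : Idx K) :
    UpperFinite fun k => d k m := by
  obtain ⟨S, hS⟩ := hd
  refine InLat1.upperFinite ⟨S.image Prod.fst, fun k hk => ?_⟩
  obtain ⟨s, hs, h, -⟩ := hS k m hk
  exact ⟨s.1, Finset.mem_image_of_mem _ hs, h⟩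

lemma InLat2.finite_xwPow {d : Dist2 K V} (hd : InLat2 K V d) (N m k : Idx K) :
    {q : (ℕ × ℕ) × (ℕ × ℕ) |
      d (k + natIdx q.2 + natIdx q.1) (m + N - natIdx q.1) ≠ 0}.Finite := by
  obtain ⟨S, hS⟩ := hd
  refine (S.finite_toSet.biUnion fun s _ =>
    finite_setOf_add_mem (finite_isNegIntPair_add_natIdx (k - s.1))).subset fun q hq => ?_
  obtain ⟨s, hs, h, -⟩ := hS _ _ hq
  refine Set.mem_biUnion hs ?_
  rw [Set.mem_ofPred_eq, Set.mem_ofPred_eq, add_comm q.1, natIdx_add, sub_add_eq_add_sub,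
    ← add_assoc]
  exact h

lemma InLat2.finite_wxPow {d : Dist2 K V} (hd : InLat2 K V d) (N m k : Idx K) :
    {q : (ℕ × ℕ) × (ℕ × ℕ) |
      d (k + natIdx q.2 + N - natIdx q.1) (m + natIdx q.1) ≠ 0}.Finite := by
  have hd' := hd
  obtain ⟨S, hS⟩ := hd
  refine (S.finite_toSet.biUnion fun s _ =>
    (finite_isNegIntPair_add_natIdx (m - s.2)).biUnion fun i _ =>
      (Set.finite_singleton i).prod
        (hd'.upperFinite (m + natIdx i) (k + N - natIdx i))).subset fun q hq => ?_
  obtain ⟨s, hs, -, h⟩ := hS _ _ hq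
  refine Set.mem_biUnion hs (Set.mem_biUnion (x := q.1) ?_ ⟨rfl, ?_⟩)
  · rw [Set.mem_ofPred_eq, sub_add_eq_add_sub]
    exact h
  · simp only [Set.mem_ofPred_eq] at hq ⊢
    convert hq using 2
    abel

variable [Module K V]

lemma InLat2.upperFinite_xwPow {d : Dist2 K V} (hd : InLat2 K V d) (N m : Idx K) :
    UpperFinite fun k => xwPow K V N d m k := fun k => by
  simp only [xwPow_apply]
  exact finite_support_finsum (fun i p : ℕ × ℕ => (gchoose K N.1 i.1 * gchoose K N.2 i.2) •
      d (k + natIdx p + natIdx i) (m + N - natIdx i))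
    ((hd.finite_xwPow N m k).subset fun q hq h => hq (by rw [h, smul_zero]))

lemma InLat2.upperFinite_wxPow {d : Dist2 K V} (hd : InLat2 K V d) (N m : Idx K) :
    UpperFinite fun k => wxPow K V N d m k := fun k => by
  simp only [wxPow_apply]
  exact finite_support_finsum (fun i p : ℕ × ℕ => (gchoose K N.1 i.1 * gchoose K N.2 i.2) •
      d (k + natIdx p + N - natIdx i) (m + natIdx i))
    ((hd.finite_wxPow N m k).subset fun q hq h => hq (by rw [h, smul_zero]))

variable (T Tb : Module.End K V)

lemma InLat2.xwPow_expShift {d : Dist2 K V} (hd : InLat2 K V d) (N m k : Idx K) :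
    xwPow K V N (fun k m => OPEA.expShift T Tb (fun k => d k m) k) m k =
      OPEA.expShift T Tb (fun k => xwPow K V N d m k) k := by
  simp only [xwPow_apply]
  rw [expShift_finsum]
  · refine finsum_congr fun i => ?_
    rw [expShift_smul]
    simp only [OPEA.expShift, add_right_comm]
  · exact (hd.finite_xwPow N m k).subset fun q hq h => hq (by rw [h, smul_zero])

lemma InLat2.wxPow_expShift {d : Dist2 K V} (hd : InLat2 K V d) (N m k : Idx K) :
    wxPow K V N (fun k m => OPEA.expShift T Tb (fun k => d k m) k) m k =
      OPEA.expShift T Tb (fun k => wxPow K V N d m k) k := by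
  simp only [wxPow_apply]
  rw [expShift_finsum]
  · refine finsum_congr fun i => ?_
    rw [expShift_smul]
    simp only [OPEA.expShift, add_right_comm, sub_eq_add_neg]
  · exact (hd.finite_wxPow N m k).subset fun q hq h => hq (by rw [h, smul_zero])

end Lattice

section Sign

variable (K : Type*) [Field K]

lemma negOnePow_intCast [CharZero K] (j : ℤ) : negOnePow K (j : K) = (-1) ^ j := by
  have h : ∃ l : ℤ, (l : K) = (j : K) := ⟨j, rfl⟩
  rw [negOnePow, dif_pos h, Int.cast_injective h.choose_spec]

variable {K}

/-- the sign (−1)^𝐧, extended by zero to the complement of 𝕂̄ -/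
def kbarSign (n : Idx K) : K := if Kbar K n then negOnePow K (n.1 - n.2) else 0

lemma kbarSign_of_not_kbar {n : Idx K} (hn : ¬ Kbar K n) : kbarSign n = 0 := if_neg hn

lemma kbar_natIdx (p : ℕ × ℕ) : Kbar K (natIdx p) := ⟨p.1 - p.2, by simp [natIdx]⟩
variable [CharZero K]

lemma kbarSign_mul_self {n : Idx K} (hn : Kbar K n) : kbarSign n * kbarSign n = 1 := by
  rw [kbarSign, if_pos hn]
  obtain ⟨j, hj⟩ := hn
  rw [← hj, negOnePow_intCast, ← mul_zpow]
  simp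

lemma kbarSign_add (x : Idx K) {y : Idx K} (hy : Kbar K y) :
    kbarSign (x + y) = kbarSign x * kbarSign y := by
  have hxy : (x + y).1 - (x + y).2 = (x.1 - x.2) + (y.1 - y.2) := by
    simp only [Prod.fst_add, Prod.snd_add]; ring
  obtain ⟨l, hl⟩ := id hy
  rw [kbarSign, kbarSign, kbarSign, if_pos hy, hxy, ← hl]
  by_cases hx : Kbar K x
  · obtain ⟨j, hj⟩ := id hx
    rw [if_pos hx, if_pos ⟨j + l, by rw [hxy, ← hl, ← hj]; push_cast; rfl⟩, ← hj,
      ← Int.cast_add, negOnePow_intCast, negOnePow_intCast, negOnePow_intCast,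
      zpow_add₀ (by norm_num)]
  · rw [if_neg hx, if_neg, zero_mul]
    rintro ⟨j, hj⟩
    rw [hxy, ← hl] at hj
    exact hx ⟨j - l, by push_cast; rw [hj]; ring⟩

lemma kbarSign_natIdx (p : ℕ × ℕ) : kbarSign (natIdx p : Idx K) = (-1) ^ (p.1 + p.2) := by
  rw [kbarSign, if_pos (kbar_natIdx p)]
  have : (natIdx p : Idx K).1 - (natIdx p : Idx K).2 = ((p.1 - p.2 : ℤ) : K) := by simp [natIdx]
  rw [this, negOnePow_intCast, zpow_sub₀ (by norm_num), zpow_natCast, zpow_natCast, pow_add,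
    div_eq_mul_inv, ← inv_pow]
  norm_num

lemma kbarSign_add_natIdx (x : Idx K) (p : ℕ × ℕ) :
    kbarSign (x + natIdx p) = kbarSign x * (-1) ^ (p.1 + p.2) := by
  rw [kbarSign_add x (kbar_natIdx p), kbarSign_natIdx]

lemma kbarSign_sub_natIdx (x : Idx K) (p : ℕ × ℕ) :
    kbarSign (x - natIdx p) = kbarSign x * (-1) ^ (p.1 + p.2) := by
  have h := kbarSign_add_natIdx (x - natIdx p) p
  rw [sub_add_cancel] at h
  rw [h, mul_assoc, ← mul_pow]
  simp

lemma negOnePow_mul_kbarSign {N : Idx K} (hN : Kbar K N) :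
    negOnePow K (N.1 - N.2) * kbarSign N = 1 := by
  simpa only [kbarSign, if_pos hN] using kbarSign_mul_self hN

variable {V : Type*} [AddCommGroup V] [Module K V]

lemma zwPow_kbarSign_smul (N : Idx K) (e : Dist2 K V) (m k : Idx K) :
    zwPow K V N (fun m k => kbarSign k • e k m) m k = kbarSign k • xwPow K V N e m k := by
  rw [zwPow_apply, xwPow_apply, smul_finsum]
  refine finsum_congr fun i => ?_
  rw [kbarSign_add_natIdx, smul_smul, smul_smul]
  congr 1
  have h : (-1 : K) ^ (i.1 + i.2) * (-1) ^ (i.1 + i.2) = 1 := by rw [← mul_pow]; simp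
  linear_combination gchoose K N.1 i.1 * gchoose K N.2 i.2 * kbarSign k * h

lemma xwPow_kbarSign_smul (N : Idx K) (c : Dist2 K V) (m k : Idx K) :
    xwPow K V N (fun k m => kbarSign k • c m k) m k = kbarSign k • zwPow K V N c m k := by
  rw [zwPow_apply, xwPow_apply, smul_finsum]
  refine finsum_congr fun i => ?_
  rw [kbarSign_add_natIdx, smul_smul, smul_smul]
  congr 1
  ring

lemma zwPowW_kbarSign_smul {N : Idx K} (hN : Kbar K N) (e : Dist2 K V) (m k : Idx K) :
    zwPowW K V N (fun m k => kbarSign k • e k m) m k = kbarSign k • wxPow K V N e m k := by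
  rw [zwPowW_apply, wxPow_apply, smul_finsum]
  refine finsum_congr fun i => ?_
  rw [kbarSign_sub_natIdx, kbarSign_add k hN, smul_smul, smul_smul]
  congr 1
  have h : (-1 : K) ^ (i.1 + i.2) * (-1) ^ (i.1 + i.2) = 1 := by rw [← mul_pow]; simp
  have hN' := negOnePow_mul_kbarSign hN
  linear_combination gchoose K N.1 i.1 * gchoose K N.2 i.2 * kbarSign k *
    (negOnePow K (N.1 - N.2) * kbarSign N * h + hN')

lemma wxPow_kbarSign_smul {N : Idx K} (hN : Kbar K N) (c : Dist2 K V) (m k : Idx K) :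
    wxPow K V N (fun k m => kbarSign k • c m k) m k = kbarSign k • zwPowW K V N c m k := by
  rw [zwPowW_apply, wxPow_apply, smul_finsum]
  refine finsum_congr fun i => ?_
  rw [kbarSign_sub_natIdx, kbarSign_add k hN, smul_smul, smul_smul]
  congr 1
  rw [show kbarSign N = negOnePow K (N.1 - N.2) from if_pos hN]
  ring

end Sign

section Duality

variable {K : Type*} [Field K] {V : Type*} [AddCommGroup V] [Module K V]

/-- the action of e^{𝐰𝐓} on an operator-valued distribution -/
def expShiftEnd (T Tb : Module.End K V) (F : Idx K → Module.End K V)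
    (hF : ∀ v, UpperFinite fun k => F k v) (k : Idx K) : Module.End K V where
  toFun v := expShift T Tb (fun k => F k v) k
  map_add' v w := by simpa only [map_add] using expShift_add (hF v) (hF w) k
  map_smul' x v := by
    simpa only [map_smul, RingHom.id_apply] using expShift_smul x (fun k => F k v) k

lemma Kbar.neg {n : Idx K} (hn : Kbar K n) : Kbar K (-n) := by
  obtain ⟨j, hj⟩ := hn
  exact ⟨-j, by simp only [Int.cast_neg, hj, Prod.fst_neg, Prod.snd_neg]; ring⟩

lemma Kbar.add_natIdx {n : Idx K} (hn : Kbar K n) (p : ℕ × ℕ) : Kbar K (n + natIdx p) := by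
  obtain ⟨j, hj⟩ := hn
  exact ⟨j + p.1 - p.2, by simp [hj, natIdx]; ring⟩

lemma koszul_comm (p q : ZMod 2) : koszul K p q = koszul K q p := by
  simp only [koszul, and_comm]

lemma koszul_mul_self (p q : ZMod 2) : koszul K p q * koszul K p q = 1 := by
  unfold koszul; split_ifs <;> simp

lemma koszul_add_right (p q r : ZMod 2) :
    koszul K p (q + r) = koszul K p q * koszul K p r := by
  have h : ∀ q : ZMod 2, q = 0 ∨ q = 1 := by decide
  obtain rfl | rfl := h p <;> obtain rfl | rfl := h q <;> obtain rfl | rfl := h r <;>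
    simp [koszul, show (1 + 1 : ZMod 2) = 0 from rfl]

variable [CharZero K]

/-- the sign operator v ↦ (−1)^{p|v|} -/
def BFold.sign (A : BFold K V) (p : ZMod 2) : Module.End K V :=
  LinearMap.ofIsCompl A.compl (koszul K p 0 • A.ev.subtype) (koszul K p 1 • A.od.subtype)

namespace BFold

variable (A : BFold K V)

lemma sign_apply (p : ZMod 2) {v : V} {q : ZMod 2} (hv : memPar K A.ev A.od v q) :
    A.sign p v = koszul K p q • v := by
  obtain ⟨rfl, h⟩ | ⟨rfl, h⟩ := hv
  · exact LinearMap.ofIsCompl_apply_left A.compl ⟨v, h⟩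
  · exact LinearMap.ofIsCompl_apply_right A.compl ⟨v, h⟩

lemma homogeneous_induction {P : V → Prop} (hadd : ∀ v w, P v → P w → P (v + w))
    (hom : ∀ v q, memPar K A.ev A.od v q → P v) (v : V) : P v := by
  obtain ⟨x, hx, y, hy, rfl⟩ := Submodule.mem_sup.1
    (A.compl.sup_eq_top ▸ Submodule.mem_top : v ∈ A.ev ⊔ A.od)
  exact hadd x y (hom x 0 (.inl ⟨rfl, hx⟩)) (hom y 1 (.inr ⟨rfl, hy⟩))

lemma sign_sign (p : ZMod 2) (v : V) : A.sign p (A.sign p v) = v := by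
  induction v using A.homogeneous_induction with
  | hadd v w hv hw => rw [map_add, map_add, hv, hw]
  | hom v q hv =>
    rw [A.sign_apply p hv, map_smul, A.sign_apply p hv, smul_smul, koszul_mul_self, one_smul]

lemma sign_Y {a : V} {pa : ZMod 2} (ha : memPar K A.ev A.od a pa) (p : ZMod 2) (m : Idx K)
    (v : V) : A.sign p (A.Y a m v) = koszul K p pa • A.Y a m (A.sign p v) := by
  induction v using A.homogeneous_induction with
  | hadd v w hv hw => rw [map_add, map_add, hv, hw, map_add, map_add, smul_add]
  | hom v q hv =>
    rw [A.sign_apply p hv, A.sign_apply p (A.Y_par a pa ha m v q hv), map_smul, smul_smul,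
      koszul_add_right]

lemma upperFinite_Y (b v : V) : UpperFinite fun k => A.Y b k v :=
  (A.fields b v).upperFinite

lemma upperFinite_kbarSign_Y (b v : V) : UpperFinite fun k => kbarSign k • A.Y b k v :=
  (A.upperFinite_Y b v).of_zero fun k h => by rw [h, smul_zero]

variable {A} {T Tb : Module.End K V}

/-- the skew-symmetry Y(v)(𝐰)b = ± e^{𝐰𝐓} Y(b)(−𝐰)v for all v -/
lemma Y_eq_expShift (hsk : SkewSym K V A.ev A.od (fun a => A.Y a) T Tb) {b : V} {pb : ZMod 2}
    (hb : memPar K A.ev A.od b pb) (v : V) (k : Idx K) :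
    A.Y v k b = expShift T Tb (fun k => kbarSign k • A.Y b k (A.sign pb v)) k := by
  by_cases hk : Kbar K k
  · induction v using A.homogeneous_induction with
    | hadd v w hv hw =>
      rw [map_add, Pi.add_apply, LinearMap.add_apply, hv, hw,
        ← expShift_add (A.upperFinite_kbarSign_Y _ _) (A.upperFinite_kbarSign_Y _ _)]
      simp only [map_add, smul_add]
    | hom v q hv =>
      have h := (hsk b v pb q hb hv k hk).2
      rw [← one_smul K (A.Y v k b), ← koszul_mul_self pb q, mul_smul, h]
      simp only [A.sign_apply pb hv, map_smul, smul_comm _ (koszul K pb q), expShift_smul]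
      congr 1
      refine finsum_congr fun p => ?_
      have hp : kbarSign (k + natIdx p) = negOnePow K (k.1 + p.1 - (k.2 + p.2)) :=
        if_pos (hk.add_natIdx p)
      rw [map_smul, hp, divPow, LinearMap.smul_apply, smul_smul, mul_comm (negOnePow _ _)]
      rfl
  · rw [A.bounded v k hk, expShift]
    symm
    refine finsum_eq_zero_of_forall_eq_zero fun p => ?_
    rw [kbarSign_add_natIdx, kbarSign_of_not_kbar hk, zero_mul, zero_smul, map_zero]

lemma lhsXW_eq_expShift (hcomm : T * Tb = Tb * T)
    (htg : ∀ a : V, TransCov K V T Tb (A.Y a))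
    (hsk : SkewSym K V A.ev A.od (fun a => A.Y a) T Tb) {a b : V} {pb : ZMod 2}
    (hb : memPar K A.ev A.od b pb) (v : V) (m k : Idx K) :
    lhsXW K V V (fun x => A.Y x) a (fun k' => A.Y v k' b) m k =
      expShift T Tb (fun k => kbarSign k • A.Y a m (A.Y b k (A.sign pb v))) k := by
  have h : (fun k' => A.Y v k' b) = expShift T Tb fun k => kbarSign k • A.Y b k (A.sign pb v) :=
    funext (Y_eq_expShift hsk hb v)
  rw [h, lhsXW_expShift (htg a) hcomm (A.upperFinite_kbarSign_Y _ _)]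
  simp only [map_smul]

lemma Y_Y_eq_expShift
    (hsk : SkewSym K V A.ev A.od (fun a => A.Y a) T Tb) {a b : V} {pa pb : ZMod 2}
    (ha : memPar K A.ev A.od a pa) (hb : memPar K A.ev A.od b pb) (v : V) (m k : Idx K) :
    A.Y (A.Y a m v) k b = expShift T Tb
      (fun k => kbarSign k • koszul K pa pb • A.Y b k (A.Y a m (A.sign pb v))) k := by
  rw [Y_eq_expShift hsk hb, A.sign_Y ha, koszul_comm]
  simp only [map_smul]

lemma dualDirect_of_isLocal (hcomm : T * Tb = Tb * T)
    (htg : ∀ a : V, TransCov K V T Tb (A.Y a))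
    (hsk : SkewSym K V A.ev A.od (fun a => A.Y a) T Tb) {a b : V} {pa pb : ZMod 2}
    (ha : memPar K A.ev A.od a pa) (hb : memPar K A.ev A.od b pb)
    (h : IsLocal K V pa pb (A.Y a) (A.Y b)) :
    DualDirect K V V (fun x => A.Y x) (fun x => A.Y x) a b := by
  obtain ⟨r, c, h, hh, hc, hzw, hwz⟩ := h
  have hc' : ∀ i v, InLat2 K V fun k m => kbarSign k • ev2 K V (c i) (A.sign pb v) m k := fun i v =>
    (hc i (A.sign pb v)).flip.of_zero fun k m h => by rw [h, smul_zero]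
  refine ⟨r, fun i k m => expShiftEnd T Tb (fun k => kbarSign k • c i m k * A.sign pb)
    (fun v => (hc' i v).upperFinite m) k, h, hh, fun i v => (hc' i v).expShift T Tb,
    fun v m k => ?_, fun v m k => ?_⟩
  · rw [lhsXW_eq_expShift hcomm htg hsk hb]
    simp only [hzw, Finset.smul_sum, ← xwPow_kbarSign_smul]
    rw [expShift_sum _ fun i => (hc' i v).upperFinite_xwPow _ _]
    exact Finset.sum_congr rfl fun i _ => ((hc' i v).xwPow_expShift T Tb _ m k).symm
  · rw [Y_Y_eq_expShift hsk ha hb]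
    simp only [hwz, Finset.smul_sum, ← wxPow_kbarSign_smul (hh _).neg]
    rw [expShift_sum _ fun i => (hc' i v).upperFinite_wxPow _ _]
    exact Finset.sum_congr rfl fun i _ => ((hc' i v).wxPow_expShift T Tb _ m k).symm

lemma isLocal_of_dualDirect (hcomm : T * Tb = Tb * T)
    (htg : ∀ a : V, TransCov K V T Tb (A.Y a))
    (hsk : SkewSym K V A.ev A.od (fun a => A.Y a) T Tb) {a b : V} {pa pb : ZMod 2}
    (ha : memPar K A.ev A.od a pa) (hb : memPar K A.ev A.od b pb)
    (h : DualDirect K V V (fun x => A.Y x) (fun x => A.Y x) a b) :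
    IsLocal K V pa pb (A.Y a) (A.Y b) := by
  obtain ⟨s, d, h, hh, hd, hxw, hwx⟩ := h
  have hd' : ∀ j v, InLat2 K V fun k m => d j k m (A.sign pb v) := fun j v => hd j _
  have hY : ∀ v m k, kbarSign k • kbarSign k • A.Y a m (A.Y b k v) = A.Y a m (A.Y b k v) ∧
      kbarSign k • kbarSign k • koszul K pa pb • A.Y b k (A.Y a m v) =
        koszul K pa pb • A.Y b k (A.Y a m v) := fun v m k => by
    by_cases hk : Kbar K k
    · simp only [smul_smul, ← mul_assoc, kbarSign_mul_self hk, one_smul, one_mul, and_self]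
    · simp only [A.bounded b k hk, map_zero, smul_zero, and_self]
  refine ⟨s, fun j m k => kbarSign k • expShiftEnd (-T) (-Tb)
    (fun k => d j k m * A.sign pb) (fun v => (hd' j v).upperFinite m) k, h, hh,
    fun j v => ?_, fun v m k => ?_, fun v m k => ?_⟩
  · exact ((hd' j v).expShift (-T) (-Tb)).flip.of_zero fun m k h => by
      change kbarSign k • expShift (-T) (-Tb) (fun k => d j k m (A.sign pb v)) k = 0
      rw [h, smul_zero]
  · have hj : ∀ j, zwPow K V (-h j) (fun m k => kbarSign k •
        expShift (-T) (-Tb) (fun k => d j k m (A.sign pb v)) k) m k = _ := fun j =>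
      (zwPow_kbarSign_smul (-h j) (fun k m => expShift (-T) (-Tb)
        (fun k => d j k m (A.sign pb v)) k) m k).trans
        (congrArg _ ((hd' j v).xwPow_expShift (-T) (-Tb) _ m k))
    refine Eq.trans ?_ (Finset.sum_congr rfl fun j _ => (hj j).symm)
    rw [← Finset.smul_sum, ← expShift_sum _ fun j => (hd' j v).upperFinite_xwPow _ _]
    simp only [← hxw, lhsXW_eq_expShift hcomm htg hsk hb, A.sign_sign]
    rw [expShift_neg_expShift hcomm, (hY v m k).1]
    exact (A.upperFinite_Y b v).of_zero fun k h => by rw [h, map_zero, smul_zero]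
  · have hj : ∀ j, zwPowW K V (-h j) (fun m k => kbarSign k •
        expShift (-T) (-Tb) (fun k => d j k m (A.sign pb v)) k) m k = _ := fun j =>
      (zwPowW_kbarSign_smul (hh j).neg (fun k m => expShift (-T) (-Tb)
        (fun k => d j k m (A.sign pb v)) k) m k).trans
        (congrArg _ ((hd' j v).wxPow_expShift (-T) (-Tb) _ m k))
    refine Eq.trans ?_ (Finset.sum_congr rfl fun j _ => (hj j).symm)
    rw [← Finset.smul_sum, ← expShift_sum _ fun j => (hd' j v).upperFinite_wxPow _ _]
    simp only [← hwx, Y_Y_eq_expShift hsk ha hb, A.sign_sign]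
    rw [expShift_neg_expShift hcomm, (hY v m k).2]
    exact (A.upperFinite_Y b (A.Y a m v)).of_zero fun k h => by rw [h, smul_zero, smul_zero]

end BFold

end Duality

/-- in a bounded 𝕂̄-fold algebra satisfying skew-symmetry for a
translation generator 𝐓, locality in the direct channel is equivalent to duality
in the direct channel. -/
theorem stmt_13 (K : Type*) [Field K] [CharZero K]
    (V : Type*) [AddCommGroup V] [Module K V]
    (A : BFold K V)
    (T Tb : Module.End K V)
    (hT : EndPar K A.ev A.od T 0) (hTb : EndPar K A.ev A.od Tb 0)
    (hcomm : T * Tb = Tb * T)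
    (htg : ∀ a : V, TransCov K V T Tb (A.Y a))
    (hsk : SkewSym K V A.ev A.od (fun a => A.Y a) T Tb) :
    ∀ (a b : V) (pa pb : ZMod 2),
      memPar K A.ev A.od a pa → memPar K A.ev A.od b pb →
      (IsLocal K V pa pb (A.Y a) (A.Y b) ↔
        DualDirect K V V (fun x => A.Y x) (fun x => A.Y x) a b) := by
  exact fun a b pa pb ha hb => ⟨BFold.dualDirect_of_isLocal hcomm htg hsk ha hb,
    BFold.isLocal_of_dualDirect hcomm htg hsk ha hb⟩

end OPEA
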